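/- arXiv:2405.03319 — 5 statements merged into one kernel-verified Lean document; each statement's English description precedes it below -/
import Mathlib

section
/- Let n ≥ 1 and let ρ : S¹ → O(2n) be a continuous group homomorphism from the circle group into the orthogonal group of Euclidean space ℝ^{2n} whose only fixed vector is zero (i.e. if ρ(t)v = v for all t ∈ S¹ then v = 0). Then there exists a linear isometry J of ℝ^{2n} with J ∘ J = −id such that J commutes with ρ(t) for every t ∈ S¹, and moreover J commutes with every linear isometry A of ℝ^{2n} that commutes with ρ(t) for all t ∈ S¹. (Thus J is an orthogonal complex structure on ℝ^{2n} invariant under ρ and under the entire commutant of ρ in O(2n).) -/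
/-- A polynomial in a symmetric operator is symmetric. -/
theorem LinearMap.IsSymmetric.polynomial_aeval {E : Type*} [NormedAddCommGroup E]
    [InnerProductSpace ℝ E] {S : E →ₗ[ℝ] E} (hS : S.IsSymmetric) (p : Polynomial ℝ) :
    (Polynomial.aeval S p).IsSymmetric := by
  induction p using Polynomial.induction_on' with
  | add p q hp hq => rw [map_add]; exact hp.add hq
  | monomial k a =>
    intro x y
    simp [Polynomial.aeval_monomial, inner_smul_left, inner_smul_right, hS.pow k x y]

/-- A symmetric positive definite operator has an inverse square root which is a polynomial
in it. -/
theorem LinearMap.IsSymmetric.exists_aeval_mul_aeval_eq_one {E : Type*} [NormedAddCommGroup E]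
    [InnerProductSpace ℝ E] [FiniteDimensional ℝ E] {S : E →ₗ[ℝ] E} (hS : S.IsSymmetric)
    (hpos : ∀ v, v ≠ 0 → 0 < inner ℝ (S v) v) :
    ∃ p : Polynomial ℝ, S * (Polynomial.aeval S p * Polynomial.aeval S p) = 1 := by
  classical
  let b := hS.eigenvectorBasis rfl
  let ev := hS.eigenvalues rfl
  let q : Polynomial ℝ :=
    Lagrange.interpolate (Finset.univ.image ev) _root_.id fun x : ℝ => (√x)⁻¹
  refine ⟨q, b.toBasis.ext fun i => ?_⟩
  have hb : Module.End.HasEigenvector S (ev i) (b i) := hS.hasEigenvector_eigenvectorBasis rfl i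
  have h_pos : 0 < ev i := by
    have h := hpos (b i) hb.2
    rw [hb.apply_eq_smul, inner_smul_left, real_inner_self_eq_norm_sq, b.norm_eq_one] at h
    simpa using h
  have h_eval : q.eval (ev i) = (√(ev i))⁻¹ :=
    Lagrange.eval_interpolate_at_node (v := _root_.id) (i := ev i) _ (Set.injOn_id _)
      (Finset.mem_image_of_mem _ (Finset.mem_univ i))
  have h_aeval := Module.End.aeval_apply_of_hasEigenvector (p := q) hb
  rw [h_eval] at h_aeval
  have h_one : (√(ev i))⁻¹ * (√(ev i))⁻¹ * ev i = 1 := by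
    rw [← mul_inv, Real.mul_self_sqrt h_pos.le, inv_mul_cancel₀ h_pos.ne']
  simp only [OrthonormalBasis.coe_toBasis, Module.End.mul_apply, Module.End.one_apply, h_aeval,
    map_smul, hb.apply_eq_smul, smul_smul, h_one, one_smul]

/-- The orthogonal part of the polar decomposition of an injective skew-adjoint operator is a
complex structure, and commutes with everything the operator commutes with. -/
theorem exists_complexStructure_of_skew {E : Type*} [NormedAddCommGroup E]
    [InnerProductSpace ℝ E] [FiniteDimensional ℝ E] (X : E →ₗ[ℝ] E)
    (h_skew : ∀ v w, inner ℝ (X v) w = -inner ℝ v (X w)) (h_inj : ∀ v, X v = 0 → v = 0) :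
    ∃ J : E ≃ₗᵢ[ℝ] E, (∀ v, J (J v) = -v) ∧
      ∀ A : E →ₗ[ℝ] E, Commute A X → ∀ v, J (A v) = A (J v) := by
  have hS : (-(X * X)).IsSymmetric := fun v w => by simp [h_skew]
  obtain ⟨p, hp⟩ := hS.exists_aeval_mul_aeval_eq_one fun v hv => by
    have : inner ℝ ((-(X * X)) v) v = inner ℝ (X v) (X v) := by simp [h_skew (X v) v]
    rw [this]
    exact real_inner_self_pos.2 fun h => hv (h_inj v h)
  set Q := Polynomial.aeval (-(X * X)) p
  have h_comm {A : E →ₗ[ℝ] E} (hA : Commute A X) : Commute A Q :=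
    Algebra.commute_of_mem_adjoin_singleton_of_commute (Polynomial.aeval_mem_adjoin_singleton ℝ _)
      (hA.mul_right hA).neg_right
  have hXQ : Commute X Q := h_comm (Commute.refl X)
  have h_sq : X * Q * (X * Q) = -1 := by
    rw [← hp, neg_mul, neg_neg, hXQ.symm.mul_mul_mul_comm, mul_assoc]
  have h_sq' (v : E) : (X * Q) ((X * Q) v) = -v := by
    simpa using LinearMap.congr_fun h_sq v
  have hJ_skew (v w : E) : inner ℝ ((X * Q) v) w = -inner ℝ v ((X * Q) w) := by
    rw [Module.End.mul_apply, h_skew, hS.polynomial_aeval p, hXQ.eq, Module.End.mul_apply]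
  let L : E →ₗᵢ[ℝ] E := (X * Q).isometryOfInner fun v w => by
    rw [hJ_skew, h_sq', inner_neg_right, neg_neg]
  refine ⟨L.toLinearIsometryEquiv rfl, h_sq', fun A hA v => ?_⟩
  exact (LinearMap.congr_fun (hA.mul_right (h_comm hA)).eq v).symm

/-- A vector fixed by `ρ (Circle.exp 2)` is fixed by the whole circle. -/
theorem forall_circle_apply_eq_of_exp_two {E : Type*} [NormedAddCommGroup E]
    [InnerProductSpace ℝ E] (ρ : Circle →* (E ≃ₗᵢ[ℝ] E))
    (hcont : Continuous fun p : Circle × E => ρ p.1 p.2) {v : E}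
    (hv : ρ (Circle.exp 2) v = v) (t : Circle) : ρ t v = v := by
  let H : AddSubgroup ℝ :=
    { carrier := {s | ρ (Circle.exp s) v = v}
      zero_mem' := by simp
      add_mem' := fun {a b} ha hb => by
        simp only [Set.mem_ofPred_eq] at ha hb ⊢
        rw [Circle.exp_add, map_mul, LinearIsometryEquiv.coe_mul, Function.comp_apply, hb, ha]
      neg_mem' := fun {a} ha => by
        simp only [Set.mem_ofPred_eq] at ha ⊢
        rw [Circle.exp_neg, map_inv]
        exact (ρ (Circle.exp a)).symm_apply_eq.2 ha.symm }
  have h_closed : IsClosed (H : Set ℝ) :=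
    isClosed_eq (hcont.comp (Circle.exp.continuous.prodMk continuous_const)) continuous_const
  have h_irr : Irrational (2 * Real.pi / 2) := by
    rw [mul_div_cancel_left₀ _ two_ne_zero]
    exact irrational_pi
  have h_dense : Dense (H : Set ℝ) := by
    refine (dense_addSubgroupClosure_pair_iff.2 h_irr).mono ?_
    rw [SetLike.coe_subset_coe, AddSubgroup.closure_le, Set.pair_subset_iff]
    exact ⟨by simp [H], hv⟩
  have h_mem : Complex.arg t ∈ (H : Set ℝ) := by
    rw [← h_closed.closure_eq]
    exact h_dense _
  have h : ρ (Circle.exp (Complex.arg t)) v = v := h_mem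
  rwa [Circle.exp_arg] at h


/-- Lemma `lem:commuting` of the paper.  Let `ρ : S¹ → O(2n)` be a
continuous representation of the circle group by linear isometries of `ℝ^{2n}` whose only
fixed vector is `0`.  Then there is an orthogonal complex structure `J` on `ℝ^{2n}`
(`J ∘ J = -id`) commuting with `ρ` and with every linear isometry of `ℝ^{2n}` commuting
with `ρ`. -/
theorem exists_invariant_complex_structure_of_circle_rep
    (n : ℕ) (hn : 1 ≤ n)
    (ρ : Circle →* (EuclideanSpace ℝ (Fin (2 * n)) ≃ₗᵢ[ℝ] EuclideanSpace ℝ (Fin (2 * n))))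
    (hcont : Continuous fun p : Circle × EuclideanSpace ℝ (Fin (2 * n)) => ρ p.1 p.2)
    (hfix : ∀ v : EuclideanSpace ℝ (Fin (2 * n)), (∀ t : Circle, ρ t v = v) → v = 0) :
    ∃ J : EuclideanSpace ℝ (Fin (2 * n)) ≃ₗᵢ[ℝ] EuclideanSpace ℝ (Fin (2 * n)),
      (∀ v, J (J v) = -v) ∧
      (∀ (t : Circle) (v), J (ρ t v) = ρ t (J v)) ∧
      (∀ A : EuclideanSpace ℝ (Fin (2 * n)) ≃ₗᵢ[ℝ] EuclideanSpace ℝ (Fin (2 * n)),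
        (∀ (t : Circle) (v), A (ρ t v) = ρ t (A v)) → ∀ v, J (A v) = A (J v)) := by
  let U := ρ (Circle.exp 1)
  have h_skew (v w : EuclideanSpace ℝ (Fin (2 * n))) :
      inner ℝ (U v - U.symm v) w = -inner ℝ v (U w - U.symm w) := by
    have h₁ : inner ℝ (U v) w = inner ℝ v (U.symm w) := by
      rw [← U.symm.inner_map_map, U.symm_apply_apply]
    have h₂ : inner ℝ (U.symm v) w = inner ℝ v (U w) := by
      rw [← U.inner_map_map, U.apply_symm_apply]
    rw [inner_sub_left, inner_sub_right, h₁, h₂, neg_sub]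
  have h_inj (v : EuclideanSpace ℝ (Fin (2 * n))) (hv : U v - U.symm v = 0) : v = 0 := by
    refine hfix v (forall_circle_apply_eq_of_exp_two ρ hcont ?_)
    have h_two : Circle.exp 2 = Circle.exp 1 * Circle.exp 1 := by
      rw [← Circle.exp_add, one_add_one_eq_two]
    rw [h_two, map_mul]
    change U (U v) = v
    rw [sub_eq_zero.1 hv, U.apply_symm_apply]
  obtain ⟨J, hJ, h_comm⟩ := exists_complexStructure_of_skew
    (U.toLinearEquiv.toLinearMap - U.symm.toLinearEquiv.toLinearMap) h_skew h_inj
  have h_commutant (A : EuclideanSpace ℝ (Fin (2 * n)) ≃ₗᵢ[ℝ] EuclideanSpace ℝ (Fin (2 * n)))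
      (hA : ∀ (t : Circle) (v), A (ρ t v) = ρ t (A v)) (v) : J (A v) = A (J v) := by
    refine h_comm A.toLinearEquiv.toLinearMap (LinearMap.ext fun w => ?_) v
    have h₁ : A (U w) = U (A w) := hA _ w
    have h₂ : A (U.symm w) = U.symm (A w) := by
      rw [U.eq_symm_apply, ← hA _ (U.symm w)]
      exact congrArg A (U.apply_symm_apply w)
    change A (U w - U.symm w) = U (A w) - U.symm (A w)
    rw [map_sub, h₁, h₂]
  refine ⟨J, hJ, fun t => h_commutant (ρ t) fun s v => ?_, h_commutant⟩
  exact congrArg (fun T => T v) ((Commute.all t s).map ρ).eq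
end

section
/- Let n ≥ 1 and let ρ : S¹ → O(2n) be a continuous group homomorphism from the circle group into the orthogonal group of Euclidean space ℝ^{2n} whose only fixed vector is zero (i.e. if ρ(t)v = v for all t ∈ S¹ then v = 0). Then every linear isometry A of ℝ^{2n} that commutes with ρ(t) for all t ∈ S¹ satisfies det A = 1; that is, the commutant of ρ inside O(2n) is contained in SO(2n). -/
open Matrix in
theorem Matrix.det_transpose_mul_self_add_ne_zero {m : Type*} [Fintype m] [DecidableEq m]
    (T N : Matrix m m ℝ) (h : ∀ v, T *ᵥ v = 0 → N *ᵥ v = 0 → v = 0) :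
    (Tᵀ * T + Nᵀ * N).det ≠ 0 := by
  intro hdet
  obtain ⟨v, hv, hv0⟩ := Matrix.exists_mulVec_eq_zero_iff.mpr hdet
  have key : T *ᵥ v ⬝ᵥ T *ᵥ v + N *ᵥ v ⬝ᵥ N *ᵥ v = 0 := by
    have := congrArg (v ⬝ᵥ ·) hv0
    simpa [add_mulVec, dotProduct_add, ← mulVec_mulVec, dotProduct_mulVec, vecMul_transpose]
      using this
  have nonneg (w : m → ℝ) : 0 ≤ w ⬝ᵥ w := Finset.sum_nonneg fun i _ => mul_self_nonneg (w i)
  refine hv (h v ?_ ?_) <;> apply dotProduct_self_eq_zero.mp <;>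
    linarith [nonneg (T *ᵥ v), nonneg (N *ᵥ v)]

open Matrix in
/-- An orthogonal matrix commuting with an invertible skew-symmetric matrix has determinant one:
the matrix `M = (1 + Aᵀ) + i J (1 - Aᵀ)` is invertible and satisfies `A * M = Mᵀ`. -/
theorem Matrix.det_eq_one_of_commute_skew {m : Type*} [Fintype m] [DecidableEq m]
    (A J : Matrix m m ℝ) (hA : Aᵀ * A = 1) (hJ : Jᵀ = -J) (hAJ : A * J = J * A)
    (hdet : J.det ≠ 0) : A.det = 1 := by
  have hA' : A * Aᵀ = 1 := mul_eq_one_comm.mp hA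
  set T : Matrix m m ℝ := 1 + Aᵀ with hT
  set N : Matrix m m ℝ := J * (1 - Aᵀ) with hN
  have hTt : Tᵀ = 1 + A := by simp [hT]
  have hNt : Nᵀ = -(J * (1 - A)) := by
    simp [hN, hJ, Matrix.mul_sub, hAJ, neg_add_eq_sub]
  have hsymm : Tᵀ * N = Nᵀ * T := by
    rw [hTt, hNt, hT, hN]
    simp only [Matrix.mul_add, Matrix.mul_sub, Matrix.add_mul, Matrix.sub_mul, Matrix.one_mul,
      Matrix.mul_one, Matrix.neg_mul, ← Matrix.mul_assoc, hAJ]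
    simp only [Matrix.mul_assoc, hA', Matrix.mul_one]
    abel
  have hAT : A * T = Tᵀ := by rw [hTt, hT, Matrix.mul_add, hA', Matrix.mul_one, add_comm]
  have hAN : A * N = Nᵀ := by
    rw [hNt, hN, ← Matrix.mul_assoc, hAJ, Matrix.mul_assoc, Matrix.mul_sub, hA', Matrix.mul_one,
      ← Matrix.mul_neg, neg_sub]
  have hTN : (Tᵀ * T + Nᵀ * N).det ≠ 0 := by
    refine det_transpose_mul_self_add_ne_zero T N fun v hTv hNv => ?_
    have h₁ : v + Aᵀ *ᵥ v = 0 := by simpa [hT, add_mulVec] using hTv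
    have h₂ : v - Aᵀ *ᵥ v = 0 := by
      rw [hN, ← mulVec_mulVec] at hNv
      simpa [sub_mulVec] using eq_zero_of_mulVec_eq_zero hdet hNv
    have h₃ : (2 : ℝ) • v = 0 := by
      rw [two_smul]; linear_combination h₁ + h₂
    simpa using h₃
  let f : ℝ →+* ℂ := Complex.ofRealHom
  let M : Matrix m m ℂ := T.map f + Complex.I • N.map f
  have hfac : (Tᵀ.map f - Complex.I • Nᵀ.map f) * M = (Tᵀ * T + Nᵀ * N).map f := by
    have hs : Tᵀ.map f * N.map f = Nᵀ.map f * T.map f := by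
      rw [← Matrix.map_mul, ← Matrix.map_mul, hsymm]
    simp only [M, Matrix.map_add f (map_add f), Matrix.map_mul, Matrix.mul_add, Matrix.sub_mul,
      Matrix.smul_mul, Matrix.mul_smul, smul_smul, Complex.I_mul_I, hs, smul_sub]
    module
  have hM : M.det ≠ 0 := by
    intro h0
    have h1 := congrArg Matrix.det hfac
    rw [det_mul, h0, mul_zero, ← RingHom.mapMatrix_apply, ← RingHom.map_det] at h1
    exact hTN (by simpa [f] using h1.symm)
  have hAM : A.map f * M = Mᵀ := by
    simp only [M, Matrix.mul_add, Matrix.mul_smul, ← Matrix.map_mul, hAT, hAN, transpose_add,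
      transpose_smul, transpose_map]
  have h2 := congrArg Matrix.det hAM
  rw [det_mul, det_transpose, ← RingHom.mapMatrix_apply, ← RingHom.map_det] at h2
  have h3 := mul_eq_right₀ hM |>.mp h2
  simpa [f] using h3

/-- If a linear isometry `A` commutes with a linear isometry `B` whose square fixes only zero, then
`A` has determinant one: apply `Matrix.det_eq_one_of_commute_skew` with `J = B - B⁻¹`. -/
theorem LinearIsometryEquiv.det_eq_one_of_commute_of_sq_fixed_eq_zero {E : Type*}
    [NormedAddCommGroup E] [InnerProductSpace ℝ E] [FiniteDimensional ℝ E] (A B : E ≃ₗᵢ[ℝ] E)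
    (hAB : ∀ v, A (B v) = B (A v)) (hB : ∀ v, B (B v) = v → v = 0) :
    LinearMap.det (A.toLinearEquiv : E →ₗ[ℝ] E) = 1 := by
  let b := stdOrthonormalBasis ℝ E
  let φ := LinearMap.toMatrixOrthonormal b
  have hstar (U : E ≃ₗᵢ[ℝ] E) : star (U.toLinearEquiv : E →ₗ[ℝ] E) = U.symm.toLinearEquiv :=
    U.adjoint_toLinearMap_eq_symm
  let J : E →ₗ[ℝ] E := (B.toLinearEquiv : E →ₗ[ℝ] E) - B.symm.toLinearEquiv
  have hJ (v : E) (hv : J v = 0) : v = 0 := by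
    refine hB v ?_
    have : B v = B.symm v := by simpa [J, sub_eq_zero] using hv
    rw [this, B.apply_symm_apply]
  have hdet (f : E →ₗ[ℝ] E) : (φ f).det = LinearMap.det f := LinearMap.det_toMatrix b.toBasis f
  have htr (f : E →ₗ[ℝ] E) : (φ f).transpose = φ (star f) := by
    rw [map_star, Matrix.star_eq_conjTranspose, Matrix.conjTranspose_eq_transpose_of_trivial]
  rw [← hdet]
  refine Matrix.det_eq_one_of_commute_skew _ (φ J) ?_ ?_ ?_ ?_
  · rw [htr, hstar, ← map_mul, ← map_one φ]
    congr 1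
    ext v
    simp
  · rw [htr, ← map_neg, star_sub, hstar, hstar]
    congr 1
    ext v
    simp [J]
  · rw [← map_mul, ← map_mul]
    congr 1
    ext v
    have : A (B.symm v) = B.symm (A v) := by
      rw [B.eq_symm_apply, ← hAB, B.apply_symm_apply]
    simp [J, hAB, this]
  · rw [hdet]
    exact (LinearMap.isUnit_iff_ker_eq_bot J |>.mpr (LinearMap.ker_eq_bot'.mpr hJ)).map
      LinearMap.det |>.ne_zero

theorem dense_addSubgroupClosure_two_two_pi :
    Dense (AddSubgroup.closure {2, 2 * Real.pi} : Set ℝ) := by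
  rw [dense_addSubgroupClosure_pair_iff]
  convert irrational_pi.inv using 1
  field_simp

theorem Circle.map_eq_self_of_map_exp_two {E : Type*} [NormedAddCommGroup E]
    [NormedSpace ℝ E] (ρ : Circle →* (E ≃ₗᵢ[ℝ] E)) (v : E)
    (hcont : Continuous fun t => ρ t v) (hv : ρ (Circle.exp 2) v = v) (t : Circle) :
    ρ t v = v := by
  let S : AddSubgroup ℝ :=
    { carrier := {x | ρ (Circle.exp x) v = v}
      zero_mem' := by simp
      add_mem' := fun {x y} hx hy => by
        rw [Set.mem_ofPred_eq] at hx hy ⊢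
        rw [Circle.exp_add, map_mul, LinearIsometryEquiv.coe_mul, Function.comp_apply, hy, hx]
      neg_mem' := fun {x} hx => by
        rw [Set.mem_ofPred_eq] at hx ⊢
        rw [Circle.exp_neg, map_inv, LinearIsometryEquiv.coe_inv,
          LinearIsometryEquiv.symm_apply_eq, hx] }
  have hclosed : IsClosed (S : Set ℝ) :=
    isClosed_eq (hcont.comp Circle.exp.continuous) continuous_const
  have hle : AddSubgroup.closure {2, 2 * Real.pi} ≤ S := by
    rw [AddSubgroup.closure_le]
    rintro x (rfl | rfl)
    · exact hv
    · change ρ (Circle.exp (2 * Real.pi)) v = v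
      simp
  have hmem : Complex.arg t ∈ (S : Set ℝ) :=
    closure_minimal hle hclosed (dense_addSubgroupClosure_two_two_pi _)
  have : ρ (Circle.exp (Complex.arg t)) v = v := hmem
  rwa [Circle.exp_arg] at this


/-- determinant form of Lemma `lem:commuting` of the paper.  Let
`ρ : S¹ → O(2n)` be a continuous representation of the circle group by linear isometries of
`ℝ^{2n}` whose only fixed vector is `0`.  Then every linear isometry `A` of `ℝ^{2n}`
commuting with `ρ` has determinant `1`: the commutant of `ρ` in `O(2n)` is contained in
`SO(2n)`. -/
theorem det_eq_one_of_commutes_with_circle_rep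
    (n : ℕ) (hn : 1 ≤ n)
    (ρ : Circle →* (EuclideanSpace ℝ (Fin (2 * n)) ≃ₗᵢ[ℝ] EuclideanSpace ℝ (Fin (2 * n))))
    (hcont : Continuous fun p : Circle × EuclideanSpace ℝ (Fin (2 * n)) => ρ p.1 p.2)
    (hfix : ∀ v : EuclideanSpace ℝ (Fin (2 * n)), (∀ t : Circle, ρ t v = v) → v = 0) :
    ∀ A : EuclideanSpace ℝ (Fin (2 * n)) ≃ₗᵢ[ℝ] EuclideanSpace ℝ (Fin (2 * n)),
      (∀ (t : Circle) (v), A (ρ t v) = ρ t (A v)) →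
      LinearMap.det (A.toLinearEquiv : EuclideanSpace ℝ (Fin (2 * n)) →ₗ[ℝ]
        EuclideanSpace ℝ (Fin (2 * n))) = 1 := by
  intro A hA
  refine A.det_eq_one_of_commute_of_sq_fixed_eq_zero (ρ (Circle.exp 1)) (hA _) fun v hv => hfix v ?_
  refine Circle.map_eq_self_of_map_exp_two ρ v (by fun_prop) ?_
  rw [show (2 : ℝ) = 1 + 1 by norm_num, Circle.exp_add, map_mul]
  exact hv
end

section
/- Let (Γ, α, ∇) be an n-valent signed GKM graph with labels in ℤ^k, and let α̂₁ and α̂₂ be two ℤ^n-valued labelings of the oriented edges of Γ such that, for i = 1, 2: α̂_i(ē) = −α̂_i(e) for every oriented edge e, the composition of α̂_i with the projection of ℤ^n onto the first k coordinates equals α, and the GKM compatibility condition with the connection holds (for all oriented edges e, f with i(f) = i(e) one has α̂_i(∇_e f) − α̂_i(f) ∈ ℤ·α̂_i(e)). If α̂₁ and α̂₂ agree on all oriented edges incident to some fixed vertex v₀, then α̂₁ = α̂₂; that is, an extension of the labeling to ℤ^n compatible with the connection is uniquely determined by its values at one vertex. -/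
/-- A signed GKM graph of valence `n` with labels in `ℤ^k`.  The graph is encoded by its set
of *oriented edges* (darts) `D`: `bar` is the orientation reversal, `src` the initial vertex,
so the terminal vertex of `d` is `src (bar d)`.  `conn e f` is the connection `∇ₑ f`, only
meaningful when `src f = src e`. -/
structure SignedGKMGraph (V D : Type) [Fintype V] [Fintype D] [DecidableEq V] [DecidableEq D]
    (n k : ℕ) where
  /-- orientation reversal of a dart -/
  bar : D → D
  bar_bar : ∀ d, bar (bar d) = d
  bar_ne : ∀ d, bar d ≠ d
  /-- initial vertex of a dart -/
  src : D → V
  /-- the graph is `n`-valent -/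
  valence : ∀ v : V, (Finset.univ.filter fun d => src d = v).card = n
  /-- the graph is connected -/
  conn_graph : ∀ u v : V,
    Relation.ReflTransGen (fun a b => ∃ d : D, src d = a ∧ src (bar d) = b) u v
  /-- the axial labeling with values in `ℤ^k` -/
  label : D → Fin k → ℤ
  label_bar : ∀ d, label (bar d) = - label d
  /-- labels of two distinct darts at a common vertex are linearly independent over `ℚ` -/
  indep : ∀ d₁ d₂ : D, src d₁ = src d₂ → d₁ ≠ d₂ →
    LinearIndependent ℚ ![(fun i => (label d₁ i : ℚ)), (fun i => (label d₂ i : ℚ))]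
  /-- the connection: `conn e` is a bijection between the darts at `src e` and the darts at
  the terminal vertex of `e` -/
  conn : D → D → D
  conn_src : ∀ e f : D, src f = src e → src (conn e f) = src (bar e)
  conn_self : ∀ e : D, conn e e = bar e
  conn_inv : ∀ e f : D, src f = src e → conn (bar e) (conn e f) = f
  /-- compatibility of the connection with the labeling -/
  conn_compat : ∀ e f : D, src f = src e →
    ∃ c : ℤ, label (conn e f) - label f = c • label e

namespace SignedGKMGraph

variable {V D : Type} [Fintype V] [Fintype D] [DecidableEq V] [DecidableEq D] {n k : ℕ}

/-- `IsWalk G u L w`: the list of darts `L` is an edge walk from `u` to `w`. -/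
inductive IsWalk (G : SignedGKMGraph V D n k) : V → List D → V → Prop
  | nil (v : V) : IsWalk G v [] v
  | cons {u w : V} {L : List D} (d : D) (hd : G.src d = u)
      (hL : IsWalk G (G.src (G.bar d)) L w) : IsWalk G u (d :: L) w

/-- The reversed walk. -/
def wrev (G : SignedGKMGraph V D n k) (L : List D) : List D := (L.map G.bar).reverse

/-- Two edge walks are homotopic (rel endpoints) iff they are related by the equivalence
relation generated by cancellation of immediate backtracks `[d, bar d]`.  The equivalence
classes of closed walks at a base vertex form the fundamental group of the topological
realization of the graph. -/
def Homotopic (G : SignedGKMGraph V D n k) : List D → List D → Prop :=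
  Relation.EqvGen
    (fun L₁ L₂ => ∃ (p q : List D) (d : D), L₁ = p ++ d :: G.bar d :: q ∧ L₂ = p ++ q)

/-- A connection path: a closed edge path `e 0, e 1, …, e (m-1)` (indices mod `m`), with
pairwise distinct (unoriented) edges, which is invariant under the connection:
transporting the (reversed) previous edge along an edge of the path gives the next edge.
(This is the type-correct form of the condition `∇_{eᵢ} e_{i+1} = e_{i+2}`.) -/
structure IsConnPath (G : SignedGKMGraph V D n k) (m : ℕ) (e : ZMod m → D) : Prop where
  pos : 0 < m
  chain : ∀ i : ZMod m, G.src (e (i + 1)) = G.src (G.bar (e i))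
  inj : ∀ i j : ZMod m, e i = e j → i = j
  nodouble : ∀ i j : ZMod m, e i ≠ G.bar (e j)
  rule : ∀ i : ZMod m, G.conn (e (i + 1)) (G.bar (e i)) = e (i + 2)

/-- The closed walk (starting at `src (e 0)`) traversing a connection path once. -/
def cpList (m : ℕ) (e : ZMod m → D) : List D := (List.range m).map fun i => e (i : ZMod m)

/-- The loops representing connection paths. -/
def IsConnPathLoop (G : SignedGKMGraph V D n k) (c : List D) : Prop :=
  ∃ (m : ℕ) (e : ZMod m → D), G.IsConnPath m e ∧ c = cpList m e

/-- `GenProd G gen v L`: the closed walk `L` at `v` is literally a concatenation of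
conjugates `w · c · w⁻¹` of loops `c` (or their inverses) belonging to the family `gen`. -/
inductive GenProd (G : SignedGKMGraph V D n k) (gen : List D → Prop) : V → List D → Prop
  | nil (v : V) : GenProd G gen v []
  | append {v u : V} (w c L : List D) (hw : G.IsWalk v w u) (hc : G.IsWalk u c u)
      (hgen : gen c ∨ gen (G.wrev c)) (hL : GenProd G gen v L) :
      GenProd G gen v (w ++ c ++ G.wrev w ++ L)

/-- The fundamental group of the realization of the graph (at any base point) is generated
by the loops of the family `gen`: every closed walk is homotopic to a product of conjugates
of such loops and their inverses. -/
def Pi1GeneratedBy (G : SignedGKMGraph V D n k) (gen : List D → Prop) : Prop :=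
  ∀ (v : V) (L : List D), G.IsWalk v L v →
    ∃ L' : List D, G.GenProd gen v L' ∧ G.Homotopic L L'

/-- A `j`-valent GKM subgraph: a nonempty, orientation-closed, connected set of darts,
`j`-valent at each of its vertices, invariant under the connection along its own edges. -/
structure IsGKMSubgraph (G : SignedGKMGraph V D n k) (j : ℕ) (S : Set D) : Prop where
  nonempty : S.Nonempty
  bar_mem : ∀ d ∈ S, G.bar d ∈ S
  valence : ∀ v : V, (∃ d ∈ S, G.src d = v) → (S ∩ {d | G.src d = v}).ncard = j
  connected : ∀ d₁ ∈ S, ∀ d₂ ∈ S,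
    Relation.ReflTransGen (fun a b => ∃ d ∈ S, G.src d = a ∧ G.src (G.bar d) = b)
      (G.src d₁) (G.src d₂)
  conn_mem : ∀ e ∈ S, ∀ f ∈ S, G.src f = G.src e → G.conn e f ∈ S

/-- The set of darts of a connection path. -/
def cpEdges (G : SignedGKMGraph V D n k) (m : ℕ) (e : ZMod m → D) : Set D :=
  {d | ∃ i : ZMod m, d = e i ∨ d = G.bar (e i)}

/-- A spanning tree: an orientation-closed set of darts which connects any two vertices and
carries no nontrivial closed walks up to homotopy (i.e. it is simply connected). -/
structure IsSpanningTree (G : SignedGKMGraph V D n k) (T : Set D) : Prop where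
  bar_mem : ∀ d ∈ T, G.bar d ∈ T
  spanning : ∀ u v : V,
    Relation.ReflTransGen (fun a b => ∃ d ∈ T, G.src d = a ∧ G.src (G.bar d) = b) u v
  acyclic : ∀ (v : V) (L : List D), G.IsWalk v L v → (∀ d ∈ L, d ∈ T) → G.Homotopic L []

end SignedGKMGraph

namespace SignedGKMGraph

variable {V D : Type} [Fintype V] [Fintype D] [DecidableEq V] [DecidableEq D] {n k : ℕ}

lemma label_ne_zero (G : SignedGKMGraph V D n k) {e f : D} (hsrc : G.src e = G.src f)
    (hne : e ≠ f) : G.label e ≠ 0 := by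
  intro h
  refine (G.indep e f hsrc hne).ne_zero 0 ?_
  ext i
  simp [h]

lemma conn_conn_bar (G : SignedGKMGraph V D n k) {e g : D} (hg : G.src g = G.src (G.bar e)) :
    G.conn e (G.conn (G.bar e) g) = g := by
  simpa only [G.bar_bar] using G.conn_inv (G.bar e) g hg

/-- The transport coefficient of a compatible extension is already determined by `label`. -/
lemma label_conn_sub_of_extension (G : SignedGKMGraph V D n k) (hkn : k ≤ n)
    {β : D → Fin n → ℤ} (hproj : ∀ d (i : Fin k), β d (Fin.castLE hkn i) = G.label d i)
    {e f : D} {c : ℤ} (hc : β (G.conn e f) - β f = c • β e) :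
    G.label (G.conn e f) - G.label f = c • G.label e := by
  ext i
  simpa [hproj] using congrFun hc (Fin.castLE hkn i)

/-- Two compatible extensions that agree at the initial vertex of an edge agree at its
terminal vertex. -/
lemma extension_eq_at_terminal (G : SignedGKMGraph V D n k) (hkn : k ≤ n)
    {β₁ β₂ : D → Fin n → ℤ}
    (h₁bar : ∀ d, β₁ (G.bar d) = - β₁ d)
    (h₂bar : ∀ d, β₂ (G.bar d) = - β₂ d)
    (h₁proj : ∀ d (i : Fin k), β₁ d (Fin.castLE hkn i) = G.label d i)
    (h₂proj : ∀ d (i : Fin k), β₂ d (Fin.castLE hkn i) = G.label d i)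
    (h₁compat : ∀ e f : D, G.src f = G.src e → ∃ c : ℤ, β₁ (G.conn e f) - β₁ f = c • β₁ e)
    (h₂compat : ∀ e f : D, G.src f = G.src e → ∃ c : ℤ, β₂ (G.conn e f) - β₂ f = c • β₂ e)
    {e : D} (hagree : ∀ d, G.src d = G.src e → β₁ d = β₂ d)
    {g : D} (hg : G.src g = G.src (G.bar e)) : β₁ g = β₂ g := by
  obtain ⟨f, hf, rfl⟩ : ∃ f, G.src f = G.src e ∧ G.conn e f = g :=
    ⟨G.conn (G.bar e) g, by rw [G.conn_src _ _ hg, G.bar_bar], G.conn_conn_bar hg⟩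
  obtain rfl | hne := eq_or_ne e f
  · rw [G.conn_self, h₁bar, h₂bar, hagree e rfl]
  obtain ⟨c₁, hc₁⟩ := h₁compat e f hf
  obtain ⟨c₂, hc₂⟩ := h₂compat e f hf
  have hc : c₁ = c₂ := smul_left_injective ℤ (G.label_ne_zero hf.symm hne) <|
    (G.label_conn_sub_of_extension hkn h₁proj hc₁).symm.trans
      (G.label_conn_sub_of_extension hkn h₂proj hc₂)
  rw [sub_eq_iff_eq_add.mp hc₁, sub_eq_iff_eq_add.mp hc₂, hc, hagree e rfl, hagree f hf]

end SignedGKMGraph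

open SignedGKMGraph in
/-- An extension of the `ℤ^k`-labeling of a signed GKM graph to a
`ℤ^n`-labeling compatible with the connection is uniquely determined by its values on the
edges at one vertex. -/
theorem extension_unique_from_one_vertex
    {V D : Type} [Fintype V] [Fintype D] [DecidableEq V] [DecidableEq D] {n k : ℕ}
    (hkn : k ≤ n) (G : SignedGKMGraph V D n k)
    (β₁ β₂ : D → Fin n → ℤ)
    (h₁bar : ∀ d, β₁ (G.bar d) = - β₁ d)
    (h₂bar : ∀ d, β₂ (G.bar d) = - β₂ d)
    (h₁proj : ∀ d (i : Fin k), β₁ d (Fin.castLE hkn i) = G.label d i)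
    (h₂proj : ∀ d (i : Fin k), β₂ d (Fin.castLE hkn i) = G.label d i)
    (h₁compat : ∀ e f : D, G.src f = G.src e → ∃ c : ℤ, β₁ (G.conn e f) - β₁ f = c • β₁ e)
    (h₂compat : ∀ e f : D, G.src f = G.src e → ∃ c : ℤ, β₂ (G.conn e f) - β₂ f = c • β₂ e)
    (v₀ : V) (hagree : ∀ d, G.src d = v₀ → β₁ d = β₂ d) :
    β₁ = β₂ := by
  have key : ∀ v : V, ∀ d, G.src d = v → β₁ d = β₂ d := by
    intro v
    induction G.conn_graph v₀ v with
    | refl => exact hagree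
    | tail _ hstep ih =>
      obtain ⟨e, rfl, rfl⟩ := hstep
      exact fun g hg =>
        G.extension_eq_at_terminal hkn h₁bar h₂bar h₁proj h₂proj h₁compat h₂compat ih hg
  exact funext fun d => key _ d rfl
end

section
/- Let (Γ, α, ∇) be a 4-independent signed GKM graph, let γ be a two-valent GKM subgraph of Γ, let v be a vertex of γ, let F(v) be the set of oriented edges at v that do not belong to γ, and let μ_γ : F(v) → F(v) be the monodromy bijection obtained by transporting each edge of F(v) once around γ via the connection (i.e. applying successively ∇_{e₁}, ∇_{e₂}, …, ∇_{e_m}, where e₁, …, e_m is the cyclic sequence of oriented edges of γ starting at v). Then μ_γ is the identity map. -/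
namespace SignedGKMGraph

variable {V D : Type} [Fintype V] [Fintype D] [DecidableEq V] [DecidableEq D] {n k : ℕ}

/-- The graph is `j`-independent: at every vertex, the labels of any `j` distinct incident
darts are linearly independent over `ℚ`. -/
def IsIndepOfOrder (G : SignedGKMGraph V D n k) (j : ℕ) : Prop :=
  ∀ (v : V) (s : Fin j → D), (∀ a, G.src (s a) = v) → Function.Injective s →
    LinearIndependent ℚ fun a : Fin j => fun i : Fin k => (G.label (s a) i : ℚ)

end SignedGKMGraph

namespace SignedGKMGraph

variable {V D : Type} [Fintype V] [Fintype D] [DecidableEq V] [DecidableEq D] {n k : ℕ}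

/-- The label of a dart as a rational vector. -/
def ratLabel (G : SignedGKMGraph V D n k) (d : D) : Fin k → ℚ := fun i => (G.label d i : ℚ)

/-- The span over `ℚ` of the labels of the darts of `S` at the vertex `v`. -/
def labelSpan (G : SignedGKMGraph V D n k) (S : Set D) (v : V) : Submodule ℚ (Fin k → ℚ) :=
  Submodule.span ℚ (G.ratLabel '' (S ∩ {d | G.src d = v}))

variable {G : SignedGKMGraph V D n k} {S : Set D} {j : ℕ}

lemma ratLabel_mem_labelSpan {d : D} (hd : d ∈ S) : G.ratLabel d ∈ G.labelSpan S (G.src d) :=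
  Submodule.subset_span ⟨d, ⟨hd, rfl⟩, rfl⟩

lemma exists_ratLabel_conn_sub_eq_smul {e f : D} (h : G.src f = G.src e) :
    ∃ c : ℤ, G.ratLabel (G.conn e f) - G.ratLabel f = (c : ℚ) • G.ratLabel e := by
  obtain ⟨c, hc⟩ := G.conn_compat e f h
  refine ⟨c, funext fun i => ?_⟩
  have := congrFun hc i
  simp only [Pi.sub_apply, Pi.smul_apply, smul_eq_mul, ratLabel] at this ⊢
  exact_mod_cast this

lemma ratLabel_conn_sub_mem_labelSpan {e f : D} (he : e ∈ S) (h : G.src f = G.src e) :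
    G.ratLabel (G.conn e f) - G.ratLabel f ∈ G.labelSpan S (G.src e) := by
  obtain ⟨c, hc⟩ := exists_ratLabel_conn_sub_eq_smul h
  rw [hc]
  exact Submodule.smul_mem _ _ (ratLabel_mem_labelSpan he)

/-- The span of the labels of a GKM subgraph does not grow along the edges of the subgraph. -/
lemma IsGKMSubgraph.labelSpan_src_bar_le (hS : G.IsGKMSubgraph j S) {d : D} (hd : d ∈ S) :
    G.labelSpan S (G.src (G.bar d)) ≤ G.labelSpan S (G.src d) := by
  refine Submodule.span_le.2 ?_
  rintro _ ⟨g, ⟨hg, hgv⟩, rfl⟩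
  have hgv : G.src g = G.src (G.bar d) := hgv
  have hh := hS.conn_mem _ (hS.bar_mem d hd) g hg hgv
  have hsrc := G.conn_src _ _ hgv
  have hinv := G.conn_inv _ _ hgv
  rw [G.bar_bar] at hsrc hinv
  have hsub := ratLabel_conn_sub_mem_labelSpan hd hsrc
  rw [hinv] at hsub
  have hmem := ratLabel_mem_labelSpan (G := G) hh
  rw [hsrc] at hmem
  simpa using add_mem hsub hmem

lemma IsGKMSubgraph.conn_notMem (hS : G.IsGKMSubgraph j S) {e f : D} (he : e ∈ S) (hf : f ∉ S)
    (h : G.src f = G.src e) : G.conn e f ∉ S := fun hc =>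
  hf (G.conn_inv e f h ▸ hS.conn_mem _ (hS.bar_mem e he) _ hc (G.conn_src e f h))

/-- Transport along a walk in a GKM subgraph preserves the darts outside the subgraph, and
changes their labels only by elements of the span of the labels of the subgraph. -/
lemma IsGKMSubgraph.foldl_conn (hS : G.IsGKMSubgraph j S) {u w : V} {L : List D}
    (hL : G.IsWalk u L w) (hmem : ∀ d ∈ L, d ∈ S) {f : D} (hf : G.src f = u) (hfS : f ∉ S) :
    G.src (L.foldl (fun g d => G.conn d g) f) = w ∧
      L.foldl (fun g d => G.conn d g) f ∉ S ∧
      G.ratLabel (L.foldl (fun g d => G.conn d g) f) - G.ratLabel f ∈ G.labelSpan S u := by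
  induction hL generalizing f with
  | nil v => simp [hf, hfS]
  | cons d hd _ ih =>
    subst hd
    obtain ⟨hdS, hmem⟩ := List.forall_mem_cons.1 hmem
    obtain ⟨h₁, h₂, h₃⟩ := ih hmem (G.conn_src d f hf) (hS.conn_notMem hdS hfS hf)
    refine ⟨h₁, h₂, ?_⟩
    simpa using add_mem (hS.labelSpan_src_bar_le hdS h₃) (ratLabel_conn_sub_mem_labelSpan hdS hf)

/-- In a `4`-independent graph, a dart outside a two-valent GKM subgraph is determined by its
label modulo the span of the labels of the subgraph. -/
lemma IsGKMSubgraph.eq_of_ratLabel_sub_mem_labelSpan (hS : G.IsGKMSubgraph 2 S)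
    (h4indep : G.IsIndepOfOrder 4) {d f g : D} (hd : d ∈ S) (hf : G.src f = G.src d) (hfS : f ∉ S)
    (hg : G.src g = G.src d) (hgS : g ∉ S)
    (h : G.ratLabel g - G.ratLabel f ∈ G.labelSpan S (G.src d)) : g = f := by
  by_contra hgf
  obtain ⟨a, b, hab, hpair⟩ := Set.ncard_eq_two.1 (hS.valence _ ⟨d, hd, rfl⟩)
  obtain ⟨haS, hav : G.src a = _⟩ : a ∈ S ∩ {e | G.src e = G.src d} := hpair ▸ by simp
  obtain ⟨hbS, hbv : G.src b = _⟩ : b ∈ S ∩ {e | G.src e = G.src d} := hpair ▸ by simp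
  rw [labelSpan, hpair, Set.image_pair, Submodule.mem_span_pair] at h
  obtain ⟨x, y, hxy⟩ := h
  have hsrc : ∀ i, G.src (![g, f, a, b] i) = G.src d := by
    intro i
    fin_cases i <;> assumption
  have hinj : Function.Injective ![g, f, a, b] := by
    have hne : ∀ {p q : D}, p ∈ S → q ∉ S → q ≠ p := fun hp hq h => hq (h ▸ hp)
    intro i i' hii
    fin_cases i <;> fin_cases i' <;>
      simp_all [hne haS hgS, hne haS hfS, hne hbS hgS, hne hbS hfS]
  have hzero := Fintype.linearIndependent_iff.1 (h4indep _ _ hsrc hinj) ![1, -1, -x, -y] (by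
    simp only [Fin.sum_univ_four]
    change (1 : ℚ) • G.ratLabel g + (-1 : ℚ) • G.ratLabel f + (-x) • G.ratLabel a
      + (-y) • G.ratLabel b = 0
    rw [sub_eq_iff_eq_add.1 hxy.symm]
    module) 0
  simp at hzero

end SignedGKMGraph

open SignedGKMGraph in
/-- Let `(Γ, α, ∇)` be a `4`-independent signed GKM graph, `S` a two-valent
GKM subgraph, `v` a vertex of `S` and `L = [e₁, …, e_m]` the cyclic sequence of oriented edges
of `S` starting at `v` (a closed walk at `v` traversing each unoriented edge of `S` exactly
once).  Then the monodromy map `μ_S` of `S`, transporting the edges at `v` not in `S` once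
around `S` by successively applying `∇_{e₁}, …, ∇_{e_m}`, is the identity map. -/
theorem monodromy_of_two_valent_subgraph_is_id
    {V D : Type} [Fintype V] [Fintype D] [DecidableEq V] [DecidableEq D] {n k : ℕ}
    (G : SignedGKMGraph V D n k)
    (h4indep : G.IsIndepOfOrder 4)
    (S : Set D) (hS : G.IsGKMSubgraph 2 S)
    (v : V) (L : List D)
    (hwalk : G.IsWalk v L v)
    (hmem : ∀ d ∈ L, d ∈ S)
    (honce : ∀ d ∈ S, L.count d + L.count (G.bar d) = 1) :
    ∀ f : D, G.src f = v → f ∉ S → L.foldl (fun g d => G.conn d g) f = f := by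
  intro f hf hfS
  cases hwalk with
  | nil => rfl
  | cons d hd hL =>
    subst hd
    obtain ⟨hsrc, hnotMem, hspan⟩ := hS.foldl_conn (.cons d rfl hL) hmem hf hfS
    exact hS.eq_of_ratLabel_sub_mem_labelSpan h4indep (hmem d List.mem_cons_self) hf hfS
      hsrc hnotMem hspan
end

section
/- Let (Γ, α, ∇) be an n-valent, 3-independent signed GKM graph with labels in ℤ^k such that for every vertex and any three distinct edges incident to it there is a unique 3-valent GKM subgraph containing them. Let γ be a connection path of Γ, let v be a vertex of γ, and suppose the labels at v are extended to ℤ^n: i.e. to each oriented edge e at v a vector α̂(e) ∈ ℤ^n is assigned whose projection to the first k coordinates is α(e), such that these n vectors are linearly independent over ℚ. Then this extension propagates consistently around γ: there is an assignment of vectors in ℤ^n, projecting to α under the projection onto the first k coordinates, to all oriented edges incident to vertices of γ, which agrees with the given extension at v, satisfies α̂(ē) = −α̂(e) for the edges of γ, and satisfies the GKM compatibility condition along every oriented edge e of γ (for every oriented edge f with i(f) = i(e), α̂(∇_e f) − α̂(f) ∈ ℤ·α̂(e)). -/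
namespace SignedGKMGraph

variable {V D : Type} [Fintype V] [Fintype D] [DecidableEq V] [DecidableEq D] {n k : ℕ}

theorem _root_.ZMod.induction_add_one {m : ℕ} (hm : 0 < m) {p : ZMod m → Prop} (i₀ : ZMod m)
    (h₀ : p i₀) (hs : ∀ i, p i → p (i + 1)) (i : ZMod m) : p i := by
  have : NeZero m := ⟨hm.ne'⟩
  have key : ∀ j : ℕ, p (i₀ + j) := by
    intro j
    induction j with
    | zero => simpa using h₀
    | succ j ih => simpa [add_assoc] using hs _ ih
  simpa using key (i - i₀).val

theorem conn_bar_conn (G : SignedGKMGraph V D n k) {e f : D} (h : G.src f = G.src (G.bar e)) :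
    G.conn e (G.conn (G.bar e) f) = f := by
  simpa [G.bar_bar] using G.conn_inv (G.bar e) f h

theorem IsGKMSubgraph.conn_mem_iff {G : SignedGKMGraph V D n k} {j : ℕ} {S : Set D}
    (hS : G.IsGKMSubgraph j S) {e f : D} (he : e ∈ S) (hf : G.src f = G.src e) :
    G.conn e f ∈ S ↔ f ∈ S := by
  refine ⟨fun h => ?_, fun h => hS.conn_mem e he f h hf⟩
  have := hS.conn_mem _ (hS.bar_mem e he) _ h (G.conn_src e f hf)
  rwa [G.conn_inv e f hf] at this

/-- A GKM subgraph containing two consecutive edges of a connection path contains the path. -/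
theorem IsConnPath.mem_of_consecutive {G : SignedGKMGraph V D n k} {m j : ℕ} {e : ZMod m → D}
    (hcp : G.IsConnPath m e) {S : Set D} (hS : G.IsGKMSubgraph j S) {i₀ : ZMod m}
    (h₀ : e i₀ ∈ S) (h₁ : e (i₀ + 1) ∈ S) (i : ZMod m) : e i ∈ S := by
  refine (ZMod.induction_add_one hcp.pos (p := fun i => e i ∈ S ∧ e (i + 1) ∈ S) i₀ ⟨h₀, h₁⟩
    (fun i hi => ⟨hi.2, ?_⟩) i).1
  rw [add_assoc, one_add_one_eq_two, ← hcp.rule i]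
  exact hS.conn_mem _ hi.2 _ (hS.bar_mem _ hi.1) (hcp.chain i).symm

/-- A subgroup containing the labels of two consecutive edges of a connection path contains
the labels of all its edges. -/
theorem IsConnPath.label_mem {G : SignedGKMGraph V D n k} {m : ℕ} {e : ZMod m → D}
    (hcp : G.IsConnPath m e) {L : Submodule ℤ (Fin k → ℤ)} {i₀ : ZMod m}
    (h₀ : G.label (e i₀) ∈ L) (h₁ : G.label (e (i₀ + 1)) ∈ L) (i : ZMod m) :
    G.label (e i) ∈ L := by
  refine (ZMod.induction_add_one hcp.pos
    (p := fun i => G.label (e i) ∈ L ∧ G.label (e (i + 1)) ∈ L) i₀ ⟨h₀, h₁⟩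
    (fun i hi => ⟨hi.2, ?_⟩) i).1
  obtain ⟨c, hc⟩ := G.conn_compat (e (i + 1)) (G.bar (e i)) (hcp.chain i).symm
  rw [hcp.rule i, G.label_bar, sub_eq_iff_eq_add] at hc
  rw [add_assoc, one_add_one_eq_two, hc]
  exact add_mem (L.smul_mem c hi.2) (neg_mem hi.1)

theorem eq_zero_of_smul_label_add_smul_label (G : SignedGKMGraph V D n k) {d₁ d₂ : D}
    (hs : G.src d₁ = G.src d₂) (hne : d₁ ≠ d₂) {x y : ℤ}
    (h : x • G.label d₁ + y • G.label d₂ = 0) : x = 0 ∧ y = 0 := by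
  have := LinearIndependent.pair_iff.1 (G.indep d₁ d₂ hs hne) (x : ℚ) (y : ℚ) (by
    funext i
    have hi := congrFun h i
    simp only [Pi.add_apply, Pi.smul_apply, smul_eq_mul, Pi.zero_apply] at hi ⊢
    exact_mod_cast hi)
  exact_mod_cast this

theorem IsIndepOfOrder.label_notMem_span_pair {G : SignedGKMGraph V D n k}
    (h3 : G.IsIndepOfOrder 3) {d₁ d₂ d₃ : D} (h₁₃ : G.src d₁ = G.src d₃)
    (h₂₃ : G.src d₂ = G.src d₃) (hne₁₂ : d₁ ≠ d₂) (hne₁₃ : d₁ ≠ d₃) (hne₂₃ : d₂ ≠ d₃) :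
    G.label d₃ ∉ Submodule.span ℤ {G.label d₁, G.label d₂} := by
  intro hmem
  obtain ⟨x, y, hxy⟩ := Submodule.mem_span_pair.1 hmem
  have hinj : Function.Injective ![d₁, d₂, d₃] := by
    intro i j
    fin_cases i <;> fin_cases j <;> simp [hne₁₂, hne₁₃, hne₂₃, hne₁₂.symm, hne₁₃.symm, hne₂₃.symm]
  have hli := h3 (G.src d₃) ![d₁, d₂, d₃] (by intro i; fin_cases i <;> simp [h₁₃, h₂₃]) hinj
  have := Fintype.linearIndependent_iff.1 hli ![(x : ℚ), (y : ℚ), -1] (by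
    funext i
    have hi := congrFun hxy i
    simp only [Pi.add_apply, Pi.smul_apply, smul_eq_mul] at hi
    simp only [Fin.sum_univ_three, Pi.add_apply, Pi.smul_apply, smul_eq_mul, Pi.zero_apply,
      Matrix.cons_val_zero, Matrix.cons_val_one, Matrix.cons_val, neg_mul, one_mul]
    rw [← hi]
    push_cast
    ring) 2
  simp at this

/-- A `3`-valent GKM subgraph has at most one dart at a vertex besides two given ones. -/
theorem IsGKMSubgraph.eq_of_mem {G : SignedGKMGraph V D n k} {S : Set D}
    (hS : G.IsGKMSubgraph 3 S) {v : V} {d₁ d₂ d d' : D} (h₁ : d₁ ∈ S) (h₂ : d₂ ∈ S) (hd : d ∈ S)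
    (hd' : d' ∈ S) (hs₁ : G.src d₁ = v) (hs₂ : G.src d₂ = v) (hs : G.src d = v)
    (hs' : G.src d' = v) (h₁₂ : d₁ ≠ d₂) (h₁d : d₁ ≠ d) (h₂d : d₂ ≠ d) (h₁d' : d₁ ≠ d')
    (h₂d' : d₂ ≠ d') : d = d' := by
  by_contra hne
  have hsub : ((({d₁, d₂, d, d'} : Finset D)) : Set D) ⊆ S ∩ {d | G.src d = v} := by
    intro x hx
    simp only [Finset.coe_insert, Finset.coe_singleton, Set.mem_insert_iff,
      Set.mem_singleton_iff] at hx
    rcases hx with rfl | rfl | rfl | rfl <;> exact ⟨by assumption, by assumption⟩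
  have hle := Set.ncard_le_ncard hsub (Set.toFinite _)
  rw [hS.valence v ⟨d, hd, hs⟩, Set.ncard_coe_finset] at hle
  have : ({d₁, d₂, d, d'} : Finset D).card = 4 := by
    simp [Finset.card_insert_of_notMem, *]
  omega

/-- The dart `f` corresponds to the dart `d` along the path `e`, modulo labels in `L`: the labels
are congruent mod `L`, and `f`, `d` lie in the same `3`-valent GKM subgraphs around the path. -/
def Corresponds (G : SignedGKMGraph V D n k) {m : ℕ} (e : ZMod m → D)
    (L : Submodule ℤ (Fin k → ℤ)) (f d : D) : Prop :=
  G.label f - G.label d ∈ L ∧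
    ∀ S : Set D, G.IsGKMSubgraph 3 S → (∀ i, e i ∈ S) → (f ∈ S ↔ d ∈ S)

theorem Corresponds.conn {G : SignedGKMGraph V D n k} {m : ℕ} {e : ZMod m → D}
    {L : Submodule ℤ (Fin k → ℤ)} (hL : ∀ i, G.label (e i) ∈ L) {f d : D} {i : ZMod m}
    (hf : G.src f = G.src (e i)) (h : G.Corresponds e L f d) :
    G.Corresponds e L (G.conn (e i) f) d := by
  refine ⟨?_, fun S hS heS => (hS.conn_mem_iff (heS i) hf).trans (h.2 S hS heS)⟩
  obtain ⟨c, hc⟩ := G.conn_compat (e i) f hf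
  have := add_mem (L.smul_mem c (hL i)) h.1
  rwa [← hc, sub_add_sub_cancel] at this

theorem IsConnPath.exists_corresponds {G : SignedGKMGraph V D n k} {m : ℕ} {e : ZMod m → D}
    (hcp : G.IsConnPath m e) {L : Submodule ℤ (Fin k → ℤ)} (hL : ∀ i, G.label (e i) ∈ L)
    (i₀ i : ZMod m) :
    ∀ f, G.src f = G.src (e i) → ∃ d, G.src d = G.src (e i₀) ∧ G.Corresponds e L f d := by
  refine ZMod.induction_add_one hcp.pos
    (p := fun i => ∀ f, G.src f = G.src (e i) →
      ∃ d, G.src d = G.src (e i₀) ∧ G.Corresponds e L f d) i₀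
    (fun f hf => ⟨f, hf, by simp [Corresponds]⟩) (fun i ih f hf => ?_) i
  rw [hcp.chain i] at hf
  have hsrc : G.src (G.conn (G.bar (e i)) f) = G.src (e i) := by
    rw [G.conn_src _ _ hf, G.bar_bar]
  obtain ⟨d, hd, hfd⟩ := ih _ hsrc
  refine ⟨d, hd, ?_⟩
  rw [← G.conn_bar_conn hf]
  exact hfd.conn hL hsrc

end SignedGKMGraph

open SignedGKMGraph in
/-- propagation of an extension of the labeling around a connection path;
third step in the proof of Theorem `ext` of the paper.  Let `(Γ, α, ∇)` be an `n`-valent,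
`3`-independent signed GKM graph such that any three distinct edges at a vertex lie on a
unique `3`-valent GKM subgraph.  Let `γ = (e i)` be a connection path, `v = src (e i₀)` a
vertex of `γ`, and let `a` be an extension of the labels at `v` to linearly independent
vectors in `ℤ^n`.  Then `a` propagates consistently around `γ`: there is an assignment `β`
of vectors in `ℤ^n`, projecting to `α`, to all oriented edges incident to vertices of `γ`,
agreeing with `a` at `v`, antisymmetric on the edges of `γ`, and satisfying the GKM
compatibility condition along every edge of `γ`. -/
theorem extension_propagates_around_connection_path
    {V D : Type} [Fintype V] [Fintype D] [DecidableEq V] [DecidableEq D] {n k : ℕ}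
    (hkn : k ≤ n) (G : SignedGKMGraph V D n k)
    (h3indep : G.IsIndepOfOrder 3)
    (huniq : ∀ (v : V) (d₁ d₂ d₃ : D), G.src d₁ = v → G.src d₂ = v → G.src d₃ = v →
      d₁ ≠ d₂ → d₁ ≠ d₃ → d₂ ≠ d₃ →
      ∃! S : Set D, G.IsGKMSubgraph 3 S ∧ d₁ ∈ S ∧ d₂ ∈ S ∧ d₃ ∈ S)
    (m : ℕ) (e : ZMod m → D) (hcp : G.IsConnPath m e)
    (i₀ : ZMod m) (v : V) (hv : v = G.src (e i₀))
    (a : D → Fin n → ℤ)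
    (haproj : ∀ d, G.src d = v → ∀ i : Fin k, a d (Fin.castLE hkn i) = G.label d i)
    (haind : LinearIndependent ℚ
      fun d : {d : D // G.src d = v} => fun i : Fin n => (a d.1 i : ℚ)) :
    ∃ β : D → Fin n → ℤ,
      (∀ d, (∃ i : ZMod m, G.src d = G.src (e i)) →
        ∀ i : Fin k, β d (Fin.castLE hkn i) = G.label d i) ∧
      (∀ d, G.src d = v → β d = a d) ∧
      (∀ i : ZMod m, β (G.bar (e i)) = - β (e i)) ∧
      (∀ (i : ZMod m) (f : D), G.src f = G.src (e i) →
        ∃ c : ℤ, β (G.conn (e i) f) - β f = c • β (e i)) := by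
  obtain ⟨j₀, rfl⟩ : ∃ j, i₀ = j + 1 := ⟨i₀ - 1, by ring⟩
  subst hv
  set p := e (j₀ + 1) with hp
  set q := G.bar (e j₀) with hq
  have hsq : G.src q = G.src p := (hcp.chain j₀).symm
  have hpq : p ≠ q := hcp.nodouble _ _
  let π : (Fin n → ℤ) →ₗ[ℤ] (Fin k → ℤ) := LinearMap.funLeft ℤ ℤ (Fin.castLE hkn)
  have hπa : ∀ d, G.src d = G.src p → π (a d) = G.label d := fun d hd => funext (haproj d hd)
  let W : Submodule ℤ (Fin n → ℤ) := Submodule.span ℤ {a p, a q}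
  let L : Submodule ℤ (Fin k → ℤ) := Submodule.span ℤ {G.label p, G.label q}
  have hpW : a p ∈ W := Submodule.subset_span (by simp)
  have hqW : a q ∈ W := Submodule.subset_span (by simp)
  have hLW : ∀ w ∈ L, ∃ x ∈ W, π x = w := by
    intro w hw
    obtain ⟨x, y, rfl⟩ := Submodule.mem_span_pair.1 hw
    exact ⟨x • a p + y • a q, add_mem (W.smul_mem x hpW) (W.smul_mem y hqW), by
      rw [map_add, map_smul, map_smul, hπa p rfl, hπa q hsq]⟩
  have hker : ∀ w ∈ W, π w = 0 → w = 0 := by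
    intro w hw h
    obtain ⟨x, y, rfl⟩ := Submodule.mem_span_pair.1 hw
    rw [map_add, map_smul, map_smul, hπa p rfl, hπa q hsq] at h
    obtain ⟨rfl, rfl⟩ := G.eq_zero_of_smul_label_add_smul_label hsq.symm hpq h
    simp
  have hL : ∀ i, G.label (e i) ∈ L := by
    refine hcp.label_mem (i₀ := j₀) ?_ (Submodule.subset_span (by simp [hp]))
    rw [← neg_neg (G.label (e j₀)), ← G.label_bar]
    exact neg_mem (Submodule.subset_span (by simp [hq]))
  have hpair : ∀ d, G.src d = G.src p → G.label d ∈ L → a d ∈ W := by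
    intro d hd hdL
    by_cases h₁ : p = d
    · exact h₁ ▸ hpW
    by_cases h₂ : q = d
    · exact h₂ ▸ hqW
    exact absurd hdL (h3indep.label_notMem_span_pair hd.symm (hsq.trans hd.symm) hpq h₁ h₂)
  have huniq' : ∀ f d d', G.src d = G.src p → G.src d' = G.src p → G.Corresponds e L f d →
      G.Corresponds e L f d' → a d - a d' ∈ W := by
    intro f d d' hd hd' h h'
    have hdd : G.label d' - G.label d ∈ L := by
      simpa using sub_mem h.1 h'.1
    by_cases hdL : G.label d ∈ L
    · exact sub_mem (hpair d hd hdL) (hpair d' hd' (by simpa using add_mem hdd hdL))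
    have hdL' : G.label d' ∉ L := fun h => hdL (by simpa using sub_mem h hdd)
    have hpL : G.label p ∈ L := Submodule.subset_span (by simp)
    have hqL : G.label q ∈ L := Submodule.subset_span (by simp)
    have hpd : p ≠ d := fun h => hdL (h ▸ hpL)
    have hqd : q ≠ d := fun h => hdL (h ▸ hqL)
    obtain ⟨S, ⟨hS, hpS, hqS, hdS⟩, -⟩ := huniq (G.src p) p q d rfl hsq hd hpq hpd hqd
    have heS : ∀ i, e i ∈ S := hcp.mem_of_consecutive hS (i₀ := j₀)
      (by simpa [hq, G.bar_bar] using hS.bar_mem q hqS) hpS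
    have hdS' : d' ∈ S := (h'.2 S hS heS).1 ((h.2 S hS heS).2 hdS)
    rw [hS.eq_of_mem hpS hqS hdS hdS' rfl hsq hd hd' hpq hpd hqd
      (fun h => hdL' (h ▸ hpL)) (fun h => hdL' (h ▸ hqL)), sub_self]
    exact W.zero_mem
  let Q : D → (Fin n → ℤ) → Prop := fun f x =>
    π x = G.label f ∧ ∃ d, G.src d = G.src p ∧ G.Corresponds e L f d ∧ x - a d ∈ W
  have hQuniq : ∀ f x y, Q f x → Q f y → x = y := by
    rintro f x y ⟨hx, d, hd, hfd, hxd⟩ ⟨hy, d', hd', hfd', hyd'⟩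
    refine sub_eq_zero.1 (hker _ ?_ (by rw [map_sub, hx, hy, sub_self]))
    have := add_mem (sub_mem hxd hyd') (huniq' f d d' hd hd' hfd hfd')
    convert this using 1
    abel
  have hQex : ∀ f, ∃ x, (∃ i, G.src f = G.src (e i)) → Q f x := by
    intro f
    by_cases hf : ∃ i, G.src f = G.src (e i)
    · obtain ⟨i, hi⟩ := hf
      obtain ⟨d, hd, hfd⟩ := hcp.exists_corresponds hL (j₀ + 1) i f hi
      obtain ⟨w, hw, hπw⟩ := hLW _ hfd.1
      exact ⟨a d + w, fun _ => ⟨by rw [map_add, hπa d hd, hπw]; abel, d, hd, hfd, by simpa⟩⟩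
    · exact ⟨0, fun h => absurd h hf⟩
  choose β hβ using hQex
  have hβW : ∀ i, β (e i) ∈ W := by
    intro i
    obtain ⟨-, d, hd, hed, hmem⟩ := hβ (e i) ⟨i, rfl⟩
    have : G.label d ∈ L := by simpa using sub_mem (hL i) hed.1
    simpa using add_mem hmem (hpair d hd this)
  have hcompat : ∀ (i : ZMod m) (f : D), G.src f = G.src (e i) → ∀ c : ℤ,
      G.label (G.conn (e i) f) - G.label f = c • G.label (e i) →
      β (G.conn (e i) f) = β f + c • β (e i) := by
    intro i f hf c hc
    have hsrc : G.src (G.conn (e i) f) = G.src (e (i + 1)) := by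
      rw [G.conn_src _ _ hf, hcp.chain]
    obtain ⟨hπf, d, hd, hfd, hmem⟩ := hβ f ⟨i, hf⟩
    refine hQuniq _ _ _ (hβ _ ⟨i + 1, hsrc⟩) ⟨?_, d, hd, hfd.conn hL hf, ?_⟩
    · rw [map_add, map_smul, hπf, (hβ (e i) ⟨i, rfl⟩).1, ← hc]
      abel
    · rw [add_sub_right_comm]
      exact add_mem hmem (W.smul_mem c (hβW i))
  refine ⟨β, fun d hd i => congrFun (hβ d hd).1 i, fun d hd => ?_, fun i => ?_, fun i f hf => ?_⟩
  · exact hQuniq d _ _ (hβ d ⟨j₀ + 1, hd⟩)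
      ⟨hπa d hd, d, hd, by simp [Corresponds], by simp⟩
  · have := hcompat i (e i) rfl (-2) (by rw [G.conn_self, G.label_bar]; module)
    rw [G.conn_self] at this
    rw [this]
    module
  · obtain ⟨c, hc⟩ := G.conn_compat (e i) f hf
    exact ⟨c, by rw [hcompat i f hf c hc, add_sub_cancel_left]⟩
end
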